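/- Let G be a simple graph on a finite vertex set and let τ be a 2-switch on G. Then |ω(τ(G)) − ω(G)| ≤ 1, where ω denotes the clique number. That is, the clique number is stable under 2-switch. -/

import Mathlib

open SimpleGraph

variable {V : Type*}

/-- The graph obtained from `G` by the 2-switch deleting the edges `ab`, `cd`
and adding the edges `ac`, `bd`. -/
def switched (G : SimpleGraph V) (a b c d : V) : SimpleGraph V :=
  SimpleGraph.fromEdgeSet ((G.edgeSet \ {s(a, b), s(c, d)}) ∪ {s(a, c), s(b, d)})

/-- `a, b, c, d` form a valid 2-switch configuration in `G`: they are four distinct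
vertices with `ab, cd ∈ E(G)` and `ac, bd ∉ E(G)`. -/
def IsSwitchPair (G : SimpleGraph V) (a b c d : V) : Prop :=
  a ≠ b ∧ a ≠ c ∧ a ≠ d ∧ b ≠ c ∧ b ≠ d ∧ c ≠ d ∧
    G.Adj a b ∧ G.Adj c d ∧ ¬ G.Adj a c ∧ ¬ G.Adj b d

/-- `H` is obtained from `G` by a 2-switch. -/
def TwoSwitch (G H : SimpleGraph V) : Prop :=
  ∃ a b c d : V, IsSwitchPair G a b c d ∧ H = switched G a b c d

/-- `s` is the edge set of some cycle of `G`. -/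
def IsCycleEdgeSet (G : SimpleGraph V) (s : Set (Sym2 V)) : Prop :=
  ∃ (v : V) (w : G.Walk v v), w.IsCycle ∧ s = {e | e ∈ w.edges}

/-- Every connected component of `G` contains at most one cycle: any two cycles
lying in the same component have the same edge set. -/
def IsPseudoforest (G : SimpleGraph V) : Prop :=
  ∀ (u v : V) (p : G.Walk u u) (q : G.Walk v v),
    p.IsCycle → q.IsCycle → G.Reachable u v → {e | e ∈ p.edges} = {e | e ∈ q.edges}

/-- `G` is connected and contains exactly one cycle. -/
def IsUnicyclic (G : SimpleGraph V) : Prop :=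
  G.Connected ∧ ∃! s : Set (Sym2 V), IsCycleEdgeSet G s

/-- The number of connected components of `G`. -/
noncomputable def kappa (G : SimpleGraph V) : ℕ :=
  Nat.card G.ConnectedComponent

/-- The number of connected components of `G` containing a cycle. -/
noncomputable def cyc (G : SimpleGraph V) : ℕ :=
  Nat.card {C : G.ConnectedComponent // ∃ (v : V) (w : G.Walk v v),
    G.connectedComponentMk v = C ∧ w.IsCycle}

/-- The clique number of `G`: the maximum size of a set of pairwise adjacent
vertices of `G`. -/
noncomputable def cliqueNumber {V : Type*} [Fintype V] (G : SimpleGraph V) : ℕ :=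
  sSup {n : ℕ | ∃ s : Set V, G.IsClique s ∧ s.ncard = n}

lemma switched_adj {G : SimpleGraph V} {a b c d u v : V} :
    (switched G a b c d).Adj u v ↔
      (G.Adj u v ∧ s(u, v) ≠ s(a, b) ∧ s(u, v) ≠ s(c, d) ∨
        s(u, v) = s(a, c) ∨ s(u, v) = s(b, d)) ∧ u ≠ v := by
  rw [switched, fromEdgeSet_adj, Set.mem_union, Set.mem_sdiff, mem_edgeSet]
  simp only [Set.mem_insert_iff, Set.mem_singleton_iff, not_or, ne_eq]

lemma bddAbove_clique_ncard [Fintype V] (G : SimpleGraph V) :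
    BddAbove {n : ℕ | ∃ s : Set V, G.IsClique s ∧ s.ncard = n} := by
  refine ⟨Nat.card V, ?_⟩
  rintro _ ⟨s, -, rfl⟩
  exact Set.ncard_le_card s

lemma ncard_le_cliqueNumber [Fintype V] {G : SimpleGraph V} {s : Set V} (hs : G.IsClique s) :
    s.ncard ≤ cliqueNumber G :=
  le_csSup (bddAbove_clique_ncard G) ⟨s, hs, rfl⟩

lemma exists_isClique_ncard_eq_cliqueNumber [Fintype V] (G : SimpleGraph V) :
    ∃ s : Set V, G.IsClique s ∧ s.ncard = cliqueNumber G :=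
  Nat.sSup_mem (s := {n : ℕ | ∃ s : Set V, G.IsClique s ∧ s.ncard = n})
    ⟨0, ∅, by simp, by simp⟩ (bddAbove_clique_ncard G)

/-- If `x` and `y` are not adjacent in `G` and every edge of `G` avoiding both of them is an
edge of `H`, then the clique number of `G` exceeds that of `H` by at most one. -/
lemma cliqueNumber_le_add_one [Fintype V] {G H : SimpleGraph V} {x y : V} (hxy : x ≠ y)
    (hG : ¬ G.Adj x y)
    (hH : ∀ u v, u ≠ x → u ≠ y → v ≠ x → v ≠ y → G.Adj u v → H.Adj u v) :
    cliqueNumber G ≤ cliqueNumber H + 1 := by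
  obtain ⟨s, hs, hcard⟩ := exists_isClique_ncard_eq_cliqueNumber G
  obtain ⟨z, hz⟩ : ∃ z, ∀ u ∈ s \ {z}, u ≠ x ∧ u ≠ y := by
    by_cases hx : x ∈ s
    · refine ⟨x, fun u hu => ⟨hu.2, ?_⟩⟩
      rintro rfl
      exact hG (hs hx hu.1 hxy)
    · refine ⟨y, fun u hu => ⟨?_, hu.2⟩⟩
      rintro rfl
      exact hx hu.1
  have hclique : H.IsClique (s \ {z}) := fun u hu v hv huv =>
    hH u v (hz u hu).1 (hz u hu).2 (hz v hv).1 (hz v hv).2 (hs hu.1 hv.1 huv)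
  have := ncard_le_cliqueNumber hclique
  have := Set.pred_ncard_le_ncard_sdiff_singleton s z
  omega

/-- The clique number is stable under 2-switch. -/
theorem cliqueNumber_stable {V : Type*} [Fintype V]
    (G H : SimpleGraph V) (hsw : TwoSwitch G H) :
    |(cliqueNumber H : ℤ) - (cliqueNumber G : ℤ)| ≤ 1 := by
  obtain ⟨a, b, c, d, ⟨hab, hac, had, hbc, hbd, hcd, -, -, hnac, -⟩, rfl⟩ := hsw
  have hle : cliqueNumber G ≤ cliqueNumber (switched G a b c d) + 1 := by
    refine cliqueNumber_le_add_one hac hnac fun u v hua huc hva hvc huv => ?_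
    rw [switched_adj]
    refine ⟨Or.inl ⟨huv, ?_, ?_⟩, huv.ne⟩ <;> simp [*]
  have hge : cliqueNumber (switched G a b c d) ≤ cliqueNumber G + 1 := by
    refine cliqueNumber_le_add_one hab ?_ fun u v hua hub hva hvb huv => ?_
    · rw [switched_adj]
      simp [hab, hac, had, hbc, hbd, hab.symm]
    · rw [switched_adj] at huv
      simpa [hua, hub, hva, hvb, and_assoc] using huv.1.imp_left And.left
  rw [abs_le]
  omega
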